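/- Let k ≥ 7, N ≥ 1, and let H' be a (k−1)-uniform hypergraph on vertex set {0, 1, ..., N−1} containing no k+1 vertices all of whose (k−1)-subsets are edges. Define a k-uniform hypergraph H on {0, 1, ..., 2^N − 1} by: a k-tuple e = (a_1 < ... < a_k) is an edge of H if and only if either (I) m(e) = 0 and {δ_1, ..., δ_{k−1}} is an edge of H', or (II) m(e) = k−3, or (III) m(e) = k−4 and δ_1 < δ_2. Then H contains no k+2 vertices all of whose k-subsets are edges. -/

import Mathlib

/-- For distinct nonnegative integers `a` and `b`, `bdelta a b` is the largest index `i`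
such that the `i`-th binary digits of `a` and `b` differ. -/
noncomputable def bdelta (a b : ℕ) : ℕ := sSup {i | a.testBit i ≠ b.testBit i}

/-- For a tuple `a 1 < a 2 < ⋯` of nonnegative integers, `dseq a i = δ(a i, a (i+1))`. -/
noncomputable def dseq (a : ℕ → ℕ) (i : ℕ) : ℕ := bdelta (a i) (a (i + 1))

/-- The index `i` is a local extremum of the δ-sequence of the tuple `a`:
`δ_{i-1} < δ_i > δ_{i+1}` or `δ_{i-1} > δ_i < δ_{i+1}`. -/
def IsLocalExt (a : ℕ → ℕ) (i : ℕ) : Prop :=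
  (dseq a (i - 1) < dseq a i ∧ dseq a (i + 1) < dseq a i) ∨
    (dseq a i < dseq a (i - 1) ∧ dseq a i < dseq a (i + 1))

open Classical in
/-- `numExtrema r a` is `m(e)`: the number of local extrema of the δ-sequence
`δ_1, …, δ_{r-1}` of an increasing `r`-tuple `e = (a 1, …, a r)`; the possible local extrema
are the indices `2 ≤ i ≤ r - 2`. -/
noncomputable def numExtrema (r : ℕ) (a : ℕ → ℕ) : ℕ :=
  ((Finset.Icc 2 (r - 2)).filter (fun i => IsLocalExt a i)).card

/-- The δ-sequence `δ_1, …, δ_{r-1}` of the `r`-tuple `(a 1, …, a r)` is strictly monotone. -/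
def DMonotone (r : ℕ) (a : ℕ → ℕ) : Prop :=
  (∀ i, 1 ≤ i → i + 1 ≤ r - 1 → dseq a i < dseq a (i + 1)) ∨
    (∀ i, 1 ≤ i → i + 1 ≤ r - 1 → dseq a (i + 1) < dseq a i)

/-- `bdelta a b` for `a < b` is the top differing bit, which is `0` in `a` and `1` in `b`. -/
lemma bdelta_spec {a b : ℕ} (h : a < b) :
    a.testBit (bdelta a b) = false ∧ b.testBit (bdelta a b) = true ∧
      ∀ j, bdelta a b < j → a.testBit j = b.testBit j := by
  set s : Set ℕ := {i | a.testBit i ≠ b.testBit i} with hs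
  have hne : s.Nonempty := by
    by_contra hcon
    rw [Set.not_nonempty_iff_eq_empty] at hcon
    refine h.ne (Nat.eq_of_testBit_eq fun i => ?_)
    by_contra hi
    have : i ∈ s := hi
    simp [hcon] at this
  have hbd : BddAbove s := by
    refine ⟨b, fun i hi => ?_⟩
    by_contra! hlt
    have hb : b < 2 ^ i := hlt.trans Nat.lt_two_pow_self
    exact hi (by rw [Nat.testBit_lt_two_pow hb, Nat.testBit_lt_two_pow (h.trans hb)])
  have hmem : a.testBit (bdelta a b) ≠ b.testBit (bdelta a b) := Nat.sSup_mem hne hbd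
  have habove : ∀ j, bdelta a b < j → a.testBit j = b.testBit j := by
    intro j hj
    by_contra hcon
    exact absurd (le_csSup hbd (show j ∈ s from hcon)) (not_le.mpr hj)
  refine ⟨?_, ?_, habove⟩ <;> by_contra hcon
  · have h1 : a.testBit (bdelta a b) = true := by simpa using hcon
    have h2 : b.testBit (bdelta a b) = false := by
      rw [h1] at hmem
      simpa using hmem.symm
    exact absurd (Nat.lt_of_testBit _ h2 h1 fun j hj => (habove j hj).symm) (by omega)
  · have h2 : b.testBit (bdelta a b) = false := by simpa using hcon
    have h1 : a.testBit (bdelta a b) = true := by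
      rw [h2] at hmem
      simpa using hmem
    exact absurd (Nat.lt_of_testBit _ h2 h1 fun j hj => (habove j hj).symm) (by omega)

lemma bdelta_eq {a b i : ℕ} (h : a.testBit i ≠ b.testBit i)
    (habove : ∀ j, i < j → a.testBit j = b.testBit j) : bdelta a b = i := by
  refine IsGreatest.csSup_eq ⟨h, fun j hj => ?_⟩
  by_contra! hlt
  exact hj (habove j hlt)

lemma bdelta_lt {a b N : ℕ} (h : a < b) (hb : b < 2 ^ N) : bdelta a b < N := by
  by_contra! hcon
  have h2 := (bdelta_spec h).2.1
  rw [Nat.testBit_lt_two_pow (hb.trans_le (Nat.pow_le_pow_right two_pos hcon))] at h2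
  simp at h2

lemma bdelta_ne {a b c : ℕ} (hab : a < b) (hbc : b < c) : bdelta a b ≠ bdelta b c := by
  intro h
  have h1 := (bdelta_spec hab).2.1
  rw [h, (bdelta_spec hbc).1] at h1
  simp at h1

lemma bdelta_trans {a b c : ℕ} (hab : a < b) (hbc : b < c) :
    bdelta a c = max (bdelta a b) (bdelta b c) := by
  obtain ⟨h1, h2, h3⟩ := bdelta_spec hab
  obtain ⟨h4, h5, h6⟩ := bdelta_spec hbc
  rcases lt_or_gt_of_ne (bdelta_ne hab hbc) with h | h
  · rw [max_eq_right h.le]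
    refine bdelta_eq ?_ fun j hj => ?_
    · rw [h3 _ h, h4, h5]; simp
    · rw [h3 j (h.trans hj), h6 j hj]
  · rw [max_eq_left h.le]
    refine bdelta_eq ?_ fun j hj => ?_
    · rw [h1, ← h6 _ h, h2]; simp
    · rw [h3 j hj, h6 j (h.trans hj)]

/-- The index `i` is an interior point of `D` where `D` does not turn. -/
def IsPass (D : ℕ → ℕ) (i : ℕ) : Prop :=
  (D (i - 1) < D i ∧ D i < D (i + 1)) ∨ (D i < D (i - 1) ∧ D (i + 1) < D i)

/-- At most one interior index of `D 1, …, D (k - 1)` is a pass, and if there is one then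
`D` starts with an ascent. -/
def AtMostOnePass (k : ℕ) (D : ℕ → ℕ) : Prop :=
  ∀ i j, 2 ≤ i → i ≤ k - 2 → 2 ≤ j → j ≤ k - 2 → IsPass D i → IsPass D j → i = j ∧ D 1 < D 2

/-- `D 1, …, D (r - 1)` is strictly monotone. -/
def SeqMono (r : ℕ) (D : ℕ → ℕ) : Prop :=
  (∀ i, 1 ≤ i → i + 1 ≤ r - 1 → D i < D (i + 1)) ∨
    (∀ i, 1 ≤ i → i + 1 ≤ r - 1 → D (i + 1) < D i)

lemma atMostOnePass_of_numExtrema {k : ℕ} (hk : 7 ≤ k) {a : ℕ → ℕ}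
    (h : numExtrema k a = k - 3 ∨ (numExtrema k a = k - 4 ∧ dseq a 1 < dseq a 2)) :
    AtMostOnePass k (dseq a) := by
  classical
  intro i j hi1 hi2 hj1 hj2 hi hj
  have key : ∀ t : Finset ℕ, t ⊆ Finset.Icc 2 (k - 2) → (∀ x ∈ t, IsPass (dseq a) x) →
      numExtrema k a + t.card ≤ k - 3 := by
    intro t ht hpass
    have hc : (Finset.Icc 2 (k - 2)).card = k - 3 := by
      rw [Nat.card_Icc]
      omega
    have hd : Disjoint ((Finset.Icc 2 (k - 2)).filter (fun i => IsLocalExt a i)) t := by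
      rw [Finset.disjoint_left]
      intro x hx hxt
      have h1 := (Finset.mem_filter.mp hx).2
      have h2 := hpass x hxt
      unfold IsLocalExt at h1
      unfold IsPass at h2
      omega
    have hu := Finset.card_le_card
      (Finset.union_subset (Finset.filter_subset (fun i => IsLocalExt a i) _) ht)
    rw [Finset.card_union_of_disjoint hd, hc] at hu
    unfold numExtrema
    convert hu
  have h1 := key {i} (by simp; omega) (by simpa using hi)
  rw [Finset.card_singleton] at h1
  refine ⟨?_, by omega⟩
  by_contra hne
  have h2 := key {i, j} (by intro x; simp; omega) (by
    intro x hx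
    rcases Finset.mem_insert.mp hx with rfl | hx
    · exact hi
    · rw [Finset.mem_singleton.mp hx]
      exact hj)
  rw [Finset.card_pair hne] at h2
  omega

/-- A sequence all of whose relevant two-term deletions are monotone or have at most one pass
is itself monotone. -/
lemma seqMono_of_deletions {k : ℕ} (hk : 7 ≤ k) {D : ℕ → ℕ}
    (hne : ∀ i, 1 ≤ i → i ≤ k → D i ≠ D (i + 1))
    (h0 : SeqMono k D ∨ AtMostOnePass k D)
    (h1 : SeqMono k (fun i => D (i + 1)) ∨ AtMostOnePass k (fun i => D (i + 1)))
    (h2 : SeqMono k (fun i => D (i + 2)) ∨ AtMostOnePass k (fun i => D (i + 2)))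
    (h3 : D 4 < D 3 → D 4 < D 5 → D 3 ≠ D 5 ∧
      (SeqMono k (fun i => if i < 4 then D i else D (i + 1)) ∨
        AtMostOnePass k (fun i => if i < 4 then D i else D (i + 1))))
    (h4 : D 5 < D 4 → D 5 < D 6 → D 4 ≠ D 6 ∧
      (SeqMono k (fun i => if i < 4 then D (i + 1) else D (i + 2)) ∨
        AtMostOnePass k (fun i => if i < 4 then D (i + 1) else D (i + 2)))) :
    SeqMono (k + 2) D := by
  have nopass : ∀ w, w ≤ 2 → IsPass D 4 → IsPass D 5 → ¬ AtMostOnePass k (fun i => D (i + w)) := by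
    intro w hw h4 h5 h
    have := h (4 - w) (5 - w) (by omega) (by omega) (by omega) (by omega)
    interval_cases w
    · exact absurd (this h4 h5).1 (by decide)
    · exact absurd (this h4 h5).1 (by decide)
    · exact absurd (this h4 h5).1 (by decide)
  by_cases hpass : IsPass D 4 ∧ IsPass D 5
  · replace h0 := h0.resolve_right (nopass 0 (by omega) hpass.1 hpass.2)
    replace h1 := h1.resolve_right (nopass 1 (by omega) hpass.1 hpass.2)
    replace h2 := h2.resolve_right (nopass 2 (by omega) hpass.1 hpass.2)
    have hd : ∀ P : ℕ → Prop, (∀ i, 1 ≤ i → i + 1 ≤ k - 1 → P i) →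
        (∀ i, 1 ≤ i → i + 1 ≤ k - 1 → P (i + 1)) → (∀ i, 1 ≤ i → i + 1 ≤ k - 1 → P (i + 2)) →
        ∀ i, 1 ≤ i → i + 1 ≤ k + 2 - 1 → P i := by
      intro P p0 p1 p2 i hi1 hi2
      by_cases hi : i + 1 ≤ k - 1
      · exact p0 i hi1 hi
      · have := p2 (i - 2) (by omega) (by omega)
        rwa [show i - 2 + 2 = i by omega] at this
    rcases h0 with h0 | h0 <;> rcases h1 with h1 | h1 <;> rcases h2 with h2 | h2
    · exact Or.inl (hd (fun i => D i < D (i + 1)) h0 h1 h2)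
    · have a := h0 3 (by omega) (by omega)
      have b := h2 1 (by omega) (by omega)
      simp only [Nat.reduceAdd] at a b
      omega
    · have a := h0 3 (by omega) (by omega)
      have b := h1 2 (by omega) (by omega)
      simp only [Nat.reduceAdd] at a b
      omega
    · have a := h0 3 (by omega) (by omega)
      have b := h1 2 (by omega) (by omega)
      simp only [Nat.reduceAdd] at a b
      omega
    · have a := h0 3 (by omega) (by omega)
      have b := h1 2 (by omega) (by omega)
      simp only [Nat.reduceAdd] at a b
      omega
    · have a := h0 3 (by omega) (by omega)
      have b := h1 2 (by omega) (by omega)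
      simp only [Nat.reduceAdd] at a b
      omega
    · have a := h0 3 (by omega) (by omega)
      have b := h2 1 (by omega) (by omega)
      simp only [Nat.reduceAdd] at a b
      omega
    · exact Or.inr (hd (fun i => D (i + 1) < D i) h0 h1 h2)
  exfalso
  have nomono : ∀ F : ℕ → ℕ, SeqMono k F → IsPass F 2 ∧ IsPass F 3 ∧ IsPass F 4 ∧ IsPass F 5 := by
    intro F hF
    unfold IsPass
    rcases hF with hF | hF <;>
    · have e1 := hF 1 (by omega) (by omega)
      have e2 := hF 2 (by omega) (by omega)
      have e3 := hF 3 (by omega) (by omega)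
      have e4 := hF 4 (by omega) (by omega)
      have e5 := hF 5 (by omega) (by omega)
      simp only [Nat.reduceAdd, Nat.reduceSub] at *
      omega
  replace h0 := h0.resolve_left fun h => hpass ((nomono _ h).2.2)
  replace h1 := h1.resolve_left fun h => hpass ⟨(nomono _ h).2.1, (nomono _ h).2.2.1⟩
  replace h2 := h2.resolve_left fun h => hpass ⟨(nomono _ h).1, (nomono _ h).2.1⟩
  have sh : ∀ w i, 2 ≤ i → (IsPass (fun i => D (i + w)) i ↔ IsPass D (i + w)) := by
    intro w i hi
    simp only [IsPass]
    rw [show i - 1 + w = i + w - 1 by omega, show i + 1 + w = i + w + 1 by omega]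
  have g1 : ∀ i j, 3 ≤ i → i ≤ k - 1 → 3 ≤ j → j ≤ k - 1 → IsPass D i → IsPass D j →
      i = j ∧ D 2 < D 3 := by
    intro i j hi1 hi2 hj1 hj2 hi hj
    have := h1 (i - 1) (j - 1) (by omega) (by omega) (by omega) (by omega)
      (by rw [sh _ _ (by omega)]; convert hi using 1; omega)
      (by rw [sh _ _ (by omega)]; convert hj using 1; omega)
    exact ⟨by omega, this.2⟩
  have g2 : ∀ i, 4 ≤ i → i ≤ k → IsPass D i → D 3 < D 4 := by
    intro i hi1 hi2 hi
    have hi' : IsPass (fun i => D (i + 2)) (i - 2) := by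
      rw [sh _ _ (by omega)]; convert hi using 1; omega
    exact (h2 (i - 2) (i - 2) (by omega) (by omega) (by omega) (by omega) hi' hi').2
  have turn : ∀ i, 3 ≤ i → i ≤ k - 1 → ¬ IsPass D i := by
    intro i hi1 hi2 hi
    have c1 := (g1 i i hi1 hi2 hi1 hi2 hi hi).2
    by_cases h3i : i = 3
    · subst h3i
      have c0 := (h0 3 3 (by omega) (by omega) (by omega) (by omega) hi hi).2
      have := (h0 3 2 (by omega) (by omega) (by omega) (by omega) hi (Or.inl ⟨c0, c1⟩)).1
      omega
    · have c2 := g2 i (by omega) (by omega) hi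
      have := (g1 i 3 hi1 hi2 (by omega) (by omega) hi (Or.inl ⟨c1, c2⟩)).1
      omega
  have t3 := turn 3 (by omega) (by omega)
  have t4 := turn 4 (by omega) (by omega)
  have t5 := turn 5 (by omega) (by omega)
  have t6 := turn 6 (by omega) (by omega)
  have n1 := hne 1 (by omega) (by omega)
  have n2 := hne 2 (by omega) (by omega)
  have n3 := hne 3 (by omega) (by omega)
  have n4 := hne 4 (by omega) (by omega)
  have n5 := hne 5 (by omega) (by omega)
  have n6 := hne 6 (by omega) (by omega)
  have n7 := hne 7 (by omega) (by omega)
  unfold IsPass at t3 t4 t5 t6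
  simp only [Nat.reduceAdd, Nat.reduceSub] at *
  by_cases u : D 2 < D 3
  · obtain ⟨h35, h3⟩ := h3 (by omega) (by omega)
    replace h3 := h3.resolve_left fun h => by
      have := nomono _ h
      simp [IsPass] at this
      omega
    have e2 := h3 2 3 (by omega) (by omega) (by omega) (by omega)
    have e3 := h3 3 3 (by omega) (by omega) (by omega) (by omega)
    have e4 := h3 4 4 (by omega) (by omega) (by omega) (by omega)
    have e5 := h3 2 4 (by omega) (by omega) (by omega) (by omega)
    simp [IsPass] at e2 e3 e4 e5
    omega
  · obtain ⟨h46, h4⟩ := h4 (by omega) (by omega)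
    replace h4 := h4.resolve_left fun h => by
      have := nomono _ h
      simp [IsPass] at this
      omega
    have e3 := h4 3 3 (by omega) (by omega) (by omega) (by omega)
    have e4 := h4 4 4 (by omega) (by omega) (by omega) (by omega)
    simp [IsPass] at e3 e4
    omega

/-- Increasing enumeration of the positive integers other than `x < y`. -/
def skipTwo (x y i : ℕ) : ℕ := if i < x then i else if i + 1 < y then i + 1 else i + 2

lemma skipTwo_lt_succ (x y i : ℕ) : skipTwo x y i < skipTwo x y (i + 1) := by
  unfold skipTwo
  split_ifs <;> omega

lemma Icc_sdiff_pair {n x y : ℕ} (hx : 1 ≤ x) (hxy : x < y) (hy : y ≤ n) :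
    Finset.Icc 1 n \ {x, y} = (Finset.Icc 1 (n - 2)).image (skipTwo x y) := by
  ext z
  simp only [Finset.mem_sdiff, Finset.mem_Icc, Finset.mem_insert, Finset.mem_singleton,
    Finset.mem_image, not_or]
  constructor
  · rintro ⟨⟨h1, h2⟩, h3, h4⟩
    refine ⟨if z < x then z else if z < y then z - 1 else z - 2, ?_, ?_⟩
    · split_ifs <;> omega
    · unfold skipTwo
      split_ifs <;> omega
  · rintro ⟨i, ⟨h1, h2⟩, rfl⟩
    unfold skipTwo
    split_ifs <;> omega

lemma bdelta_of_increasing {b : ℕ → ℕ} {n : ℕ} (hb : ∀ i, 1 ≤ i → i < n → b i < b (i + 1))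
    (hd : ∀ i, 1 ≤ i → i + 1 ≤ n - 1 → dseq b i < dseq b (i + 1)) {x : ℕ} (hx : 1 ≤ x) :
    ∀ y, x ≤ y → y < n → b x < b (y + 1) ∧ bdelta (b x) (b (y + 1)) = dseq b y := by
  intro y hy
  induction y, hy using Nat.le_induction with
  | base => exact fun h => ⟨hb x hx h, rfl⟩
  | succ y hy ih =>
    intro h
    obtain ⟨h1, h2⟩ := ih (by omega)
    have h3 := hb (y + 1) (by omega) h
    refine ⟨h1.trans h3, ?_⟩
    rw [bdelta_trans h1 h3, h2]
    exact max_eq_right (hd y (by omega) (by omega)).le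

lemma bdelta_of_decreasing {b : ℕ → ℕ} {n : ℕ} (hb : ∀ i, 1 ≤ i → i < n → b i < b (i + 1))
    (hd : ∀ i, 1 ≤ i → i + 1 ≤ n - 1 → dseq b (i + 1) < dseq b i) {x : ℕ} (hx : 1 ≤ x) :
    ∀ y, x ≤ y → y < n → b x < b (y + 1) ∧ dseq b y ≤ dseq b x ∧
      bdelta (b x) (b (y + 1)) = dseq b x := by
  intro y hy
  induction y, hy using Nat.le_induction with
  | base => exact fun h => ⟨hb x hx h, le_rfl, rfl⟩
  | succ y hy ih =>
    intro h
    obtain ⟨h1, h2, h4⟩ := ih (by omega)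
    have h3 := hb (y + 1) (by omega) h
    have h5 := hd y (by omega) (by omega)
    refine ⟨h1.trans h3, by omega, ?_⟩
    rw [bdelta_trans h1 h3, h4]
    exact max_eq_left (show dseq b (y + 1) ≤ _ by omega)

lemma exists_increasing_enum (S : Finset ℕ) :
    ∃ b : ℕ → ℕ, (∀ i, 1 ≤ i → i ≤ S.card → b i ∈ S) ∧
      ∀ i, 1 ≤ i → i < S.card → b i < b (i + 1) := by
  refine ⟨fun i => if h : i - 1 < S.card then S.orderEmbOfFin rfl ⟨i - 1, h⟩ else 0, ?_, ?_⟩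
  · intro i h1 h2
    simp only [show i - 1 < S.card by omega, dite_true]
    exact S.orderEmbOfFin_mem rfl _
  · intro i h1 h2
    simp only [show i - 1 < S.card by omega, show i + 1 - 1 < S.card by omega, dite_true]
    refine (S.orderEmbOfFin rfl).strictMono ?_
    rw [Fin.mk_lt_mk]
    omega

lemma injOn_of_seqMono {r : ℕ} {D : ℕ → ℕ} (h : SeqMono r D) :
    Set.InjOn D (Finset.Icc 1 (r - 1) : Finset ℕ) := by
  rw [Finset.coe_Icc]
  rcases h with h | h
  · refine (strictMonoOn_of_lt_add_one Set.ordConnected_Icc fun i _ hi hi' => ?_).injOn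
    exact h i hi.1 hi'.2
  · refine (strictAntiOn_of_add_one_lt Set.ordConnected_Icc fun i _ hi hi' => ?_).injOn
    exact h i hi.1 hi'.2

/-- A monotone δ-sequence of length `k + 1`: any `k - 1` of its values form the δ-sequence of a
`k`-subtuple. -/
lemma exists_subtuple_dseq {k : ℕ} {b : ℕ → ℕ} (hb : ∀ i, 1 ≤ i → i < k + 2 → b i < b (i + 1))
    (hd : SeqMono (k + 2) (dseq b)) {x y : ℕ} (hx : 1 ≤ x) (hxy : x < y) (hy : y ≤ k + 1) :
    ∃ q : ℕ → ℕ, (∀ i, q i < q (i + 1)) ∧ 1 ≤ q 1 ∧ q k ≤ k + 2 ∧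
      ∀ i, 1 ≤ i → i ≤ k - 1 → dseq (fun i => b (q i)) i = dseq b (skipTwo x y i) := by
  rcases hd with hd | hd
  · refine ⟨skipTwo (x + 1) (y + 1), skipTwo_lt_succ _ _, ?_, ?_, fun i h1 h2 => ?_⟩
    · unfold skipTwo; split_ifs <;> omega
    · unfold skipTwo; split_ifs <;> omega
    · have e : skipTwo (x + 1) (y + 1) (i + 1) = skipTwo x y i + 1 := by
        unfold skipTwo; split_ifs <;> omega
      have := skipTwo_lt_succ (x + 1) (y + 1) i
      simp only [dseq]
      rw [e]
      refine (bdelta_of_increasing hb hd ?_ _ (by omega) ?_).2 <;>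
      · unfold skipTwo; split_ifs <;> omega
  · refine ⟨skipTwo x y, skipTwo_lt_succ x y, ?_, ?_, fun i h1 h2 => ?_⟩
    · unfold skipTwo; split_ifs <;> omega
    · unfold skipTwo; split_ifs <;> omega
    · have := skipTwo_lt_succ x y i
      have e := (bdelta_of_decreasing hb hd (x := skipTwo x y i) ?_
        (skipTwo x y (i + 1) - 1) (by omega) ?_).2.2
      · rw [show skipTwo x y (i + 1) - 1 + 1 = skipTwo x y (i + 1) by omega] at e
        exact e
      all_goals unfold skipTwo; split_ifs <;> omega

/-- Let `k ≥ 7`, `N ≥ 1`, and let `E'` be a `(k-1)`-uniform hypergraph on `{0,…,N-1}`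
containing no `k+1` vertices all of whose `(k-1)`-subsets are edges. Define a `k`-uniform
hypergraph `E` on `{0,…,2^N - 1}` by: a `k`-tuple `e = (a₁ < ⋯ < a_k)` is an edge iff
(I) `m(e) = 0` (its δ-sequence is strictly monotone) and `{δ₁,…,δ_{k-1}}` is an edge of `E'`,
or (II) `m(e) = k - 3`, or (III) `m(e) = k - 4` and `δ₁ < δ₂`.
Then `E` contains no `k+2` vertices all of whose `k`-subsets are edges. -/
theorem stmt16 (k N : ℕ) (hk : 7 ≤ k) (hN : 1 ≤ N) (E' : Finset ℕ → Prop)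
    (hE' : ¬ ∃ S ⊆ Finset.range N, S.card = k + 1 ∧ ∀ e ⊆ S, e.card = k - 1 → E' e)
    (E : Finset ℕ → Prop)
    (hE : ∀ a : ℕ → ℕ, (∀ i, 1 ≤ i → i < k → a i < a (i + 1)) → a k < 2 ^ N →
      (E ((Finset.Icc 1 k).image a) ↔
        (DMonotone k a ∧ E' ((Finset.Icc 1 (k - 1)).image (dseq a))) ∨
          numExtrema k a = k - 3 ∨
          (numExtrema k a = k - 4 ∧ dseq a 1 < dseq a 2))) :
    ¬ ∃ S ⊆ Finset.range (2 ^ N), S.card = k + 2 ∧ ∀ e ⊆ S, e.card = k → E e := by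
  rintro ⟨S, hSN, hSc, hSE⟩
  obtain ⟨b, hbS, hb⟩ := exists_increasing_enum S
  rw [hSc] at hbS hb
  have hbN : ∀ i, 1 ≤ i → i ≤ k + 2 → b i < 2 ^ N := fun i h1 h2 =>
    Finset.mem_range.mp (hSN (hbS i h1 h2))
  have hbmono : ∀ i, 1 ≤ i → ∀ j, i < j → j ≤ k + 2 → b i < b j := by
    intro i hi j hij
    induction j, hij using Nat.le_induction with
    | base => exact fun h => hb i hi (by omega)
    | succ j hj ih => exact fun h => (ih (by omega)).trans (hb j (by omega) (by omega))
  have edge : ∀ q : ℕ → ℕ, (∀ i, q i < q (i + 1)) → 1 ≤ q 1 → q k ≤ k + 2 →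
      (SeqMono k (dseq fun i => b (q i)) ∧
        E' ((Finset.Icc 1 (k - 1)).image (dseq fun i => b (q i)))) ∨
      AtMostOnePass k (dseq fun i => b (q i)) := by
    intro q hq hq1 hqk
    have hqm : StrictMono q := strictMono_nat_of_lt_succ hq
    have hr : ∀ i, 1 ≤ i → i ≤ k → 1 ≤ q i ∧ q i ≤ k + 2 := fun i h1 h2 =>
      ⟨hq1.trans (hqm.monotone h1), (hqm.monotone h2).trans hqk⟩
    have hinc : ∀ i j, 1 ≤ i → i < j → j ≤ k → b (q i) < b (q j) := fun i j h1 h2 h3 =>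
      hbmono _ (hr i h1 (by omega)).1 _ (hqm h2) (hr j (by omega) h3).2
    have hsub : (Finset.Icc 1 k).image (fun i => b (q i)) ⊆ S := by
      intro z hz
      obtain ⟨i, hi, rfl⟩ := Finset.mem_image.mp hz
      rw [Finset.mem_Icc] at hi
      exact hbS _ (hr i hi.1 hi.2).1 (hr i hi.1 hi.2).2
    have hcard : ((Finset.Icc 1 k).image (fun i => b (q i))).card = k := by
      rw [Finset.card_image_of_injOn, Nat.card_Icc, Nat.add_sub_cancel]
      intro i hi j hj hij
      simp only [Finset.coe_Icc, Set.mem_Icc] at hi hj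
      simp only at hij
      rcases lt_trichotomy i j with h | h | h
      · have := hinc i j hi.1 h hj.2
        omega
      · exact h
      · have := hinc j i hj.1 h hi.2
        omega
    have h := (hE (fun i => b (q i)) (fun i h1 h2 => hinc i (i + 1) h1 (by omega) (by omega))
      (hbN _ (hr k (by omega) le_rfl).1 hqk)).mp (hSE _ hsub hcard)
    exact h.imp id (atMostOnePass_of_numExtrema hk)
  have edge' : ∀ q : ℕ → ℕ, (∀ i, q i < q (i + 1)) → 1 ≤ q 1 → q k ≤ k + 2 → ∀ D : ℕ → ℕ,
      (dseq fun i => b (q i)) = D → SeqMono k D ∨ AtMostOnePass k D := by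
    rintro q hq hq1 hqk D rfl
    exact (edge q hq hq1 hqk).imp And.left id
  have hmono : SeqMono (k + 2) (dseq b) := by
    refine seqMono_of_deletions hk ?_ ?_ ?_ ?_ ?_ ?_
    · exact fun i h1 h2 => bdelta_ne (hb i h1 (by omega)) (hb (i + 1) (by omega) (by omega))
    · exact edge' (fun i => i) (by intro i; omega) (by omega) (by omega) _ rfl
    · exact edge' (fun i => i + 1) (by intro i; omega) (by omega) (by omega) _ rfl
    · exact edge' (fun i => i + 2) (by intro i; omega) (by omega) (by omega) _ rfl
    · intro h43 h45
      have b34 := hb 3 (by omega) (by omega)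
      have b45 := hb 4 (by omega) (by omega)
      have b56 := hb 5 (by omega) (by omega)
      have e : bdelta (b 3) (b 5) = dseq b 3 := by
        rw [bdelta_trans b34 b45]
        exact max_eq_left h43.le
      refine ⟨e ▸ bdelta_ne (b34.trans b45) b56, ?_⟩
      refine edge' (fun i => if i < 4 then i else i + 1) ?_ ?_ ?_ _ ?_
      · intro i; split_ifs <;> omega
      · simp
      · split_ifs <;> omega
      · funext i
        rcases lt_trichotomy i 3 with h | rfl | h
        · simp [dseq, show i < 4 by omega, show i + 1 < 4 by omega]
        · simpa [dseq] using e
        · simp [dseq, show ¬ i < 4 by omega, show ¬ i + 1 < 4 by omega]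
    · intro h54 h56
      have b45 := hb 4 (by omega) (by omega)
      have b56 := hb 5 (by omega) (by omega)
      have b67 := hb 6 (by omega) (by omega)
      have e : bdelta (b 4) (b 6) = dseq b 4 := by
        rw [bdelta_trans b45 b56]
        exact max_eq_left h54.le
      refine ⟨e ▸ bdelta_ne (b45.trans b56) b67, ?_⟩
      refine edge' (fun i => if i < 4 then i + 1 else i + 2) ?_ ?_ ?_ _ ?_
      · intro i; split_ifs <;> omega
      · simp
      · split_ifs <;> omega
      · funext i
        rcases lt_trichotomy i 3 with h | rfl | h
        · simp [dseq, show i < 4 by omega, show i + 1 < 4 by omega]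
        · simpa [dseq] using e
        · simp [dseq, show ¬ i < 4 by omega, show ¬ i + 1 < 4 by omega]
  have hinj : Set.InjOn (dseq b) (Finset.Icc 1 (k + 1) : Finset ℕ) := injOn_of_seqMono hmono
  refine hE' ⟨(Finset.Icc 1 (k + 1)).image (dseq b), ?_, ?_, ?_⟩
  · intro z hz
    obtain ⟨i, hi, rfl⟩ := Finset.mem_image.mp hz
    rw [Finset.mem_Icc] at hi
    exact Finset.mem_range.mpr
      (bdelta_lt (hb i hi.1 (by omega)) (hbN (i + 1) (by omega) (by omega)))
  · rw [Finset.card_image_of_injOn hinj, Nat.card_Icc, Nat.add_sub_cancel]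
  · intro e he hec
    obtain ⟨J, hJ, rfl⟩ := Finset.subset_image_iff.mp he
    rw [Finset.card_image_of_injOn (hinj.mono (Finset.coe_subset.mpr hJ))] at hec
    have hc : (Finset.Icc 1 (k + 1) \ J).card = 2 := by
      rw [Finset.card_sdiff_of_subset hJ, Nat.card_Icc]
      omega
    obtain ⟨x, y, hxy, hset⟩ : ∃ x y, x < y ∧ Finset.Icc 1 (k + 1) \ J = {x, y} := by
      obtain ⟨x, y, hne, hset⟩ := Finset.card_eq_two.mp hc
      rcases lt_or_gt_of_ne hne with h | h
      · exact ⟨x, y, h, hset⟩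
      · exact ⟨y, x, h, by rw [hset, Finset.pair_comm]⟩
    have hx : x ∈ Finset.Icc 1 (k + 1) \ J := by rw [hset]; simp
    have hy : y ∈ Finset.Icc 1 (k + 1) \ J := by rw [hset]; simp
    rw [Finset.mem_sdiff, Finset.mem_Icc] at hx hy
    have hJeq : J = (Finset.Icc 1 (k - 1)).image (skipTwo x y) := by
      rw [← Finset.sdiff_sdiff_eq_self hJ, hset, Icc_sdiff_pair hx.1.1 hxy hy.1.2,
        show k + 1 - 2 = k - 1 by omega]
    obtain ⟨q, hq, hq1, hqk, hqd⟩ := exists_subtuple_dseq hb hmono hx.1.1 hxy hy.1.2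
    have himg : (Finset.Icc 1 (k - 1)).image (dseq fun i => b (q i)) = J.image (dseq b) := by
      rw [hJeq, Finset.image_image]
      refine Finset.image_congr fun i hi => ?_
      simp only [Finset.coe_Icc, Set.mem_Icc] at hi
      exact hqd i hi.1 hi.2
    rcases edge q hq hq1 hqk with h | h
    · exact himg ▸ h.2
    · exfalso
      have hval : ∀ i, 1 ≤ i → i ≤ 4 →
          dseq (fun i => b (q i)) i = dseq b (skipTwo x y i) := fun i h1 h2 =>
        hqd i h1 (by omega)
      have hm : ∀ i, 1 ≤ i → i ≤ 4 → 1 ≤ skipTwo x y i ∧ skipTwo x y i ≤ k + 1 := by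
        intro i h1 h2
        unfold skipTwo
        split_ifs <;> omega
      have s1 := skipTwo_lt_succ x y 1
      have s2 := skipTwo_lt_succ x y 2
      have s3 := skipTwo_lt_succ x y 3
      have hpass : IsPass (dseq fun i => b (q i)) 2 ∧ IsPass (dseq fun i => b (q i)) 3 := by
        unfold IsPass
        simp only [Nat.reduceAdd, Nat.reduceSub] at *
        rw [hval 1 (by omega) (by omega), hval 2 (by omega) (by omega),
          hval 3 (by omega) (by omega), hval 4 (by omega) (by omega)]
        have m1 := hm 1 (by omega) (by omega)
        have m2 := hm 2 (by omega) (by omega)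
        have m3 := hm 3 (by omega) (by omega)
        have m4 := hm 4 (by omega) (by omega)
        rcases hmono with hmono | hmono
        · have hs : StrictMonoOn (dseq b) (Set.Icc 1 (k + 1)) :=
            strictMonoOn_of_lt_add_one Set.ordConnected_Icc fun i _ hi hi' => hmono i hi.1 hi'.2
          exact ⟨Or.inl ⟨hs m1 m2 s1, hs m2 m3 s2⟩, Or.inl ⟨hs m2 m3 s2, hs m3 m4 s3⟩⟩
        · have hs : StrictAntiOn (dseq b) (Set.Icc 1 (k + 1)) :=
            strictAntiOn_of_add_one_lt Set.ordConnected_Icc fun i _ hi hi' => hmono i hi.1 hi'.2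
          exact ⟨Or.inr ⟨hs m1 m2 s1, hs m2 m3 s2⟩, Or.inr ⟨hs m2 m3 s2, hs m3 m4 s3⟩⟩
      exact absurd (h 2 3 (by omega) (by omega) (by omega) (by omega) hpass.1 hpass.2).1
        (by decide)
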